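/- Let A be a nonzero m×n real matrix and let |||·||| be any norm on the space of m×n real matrices with dual norm |||·|||*. Then the set of optimal solutions of the problem: minimize |||X||| subject to ⟨A,X⟩ ≥ 1, equals the set (|||A|||*)⁻¹ · ∂|||A|||*, i.e. the subdifferential of the dual norm at A scaled by the reciprocal of the dual norm of A. -/

import Mathlib

open scoped BigOperators Pointwise

noncomputable section

namespace LAROS

variable {m n : ℕ}

/-- Trace inner product `⟨A,X⟩ = trace(Aᵀ X)`. -/
def mInner (A X : Matrix (Fin m) (Fin n) ℝ) : ℝ := ∑ i, ∑ j, A i j * X i j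

/-- `N` is a norm on `m×n` real matrices. -/
def IsMatrixNorm (N : Matrix (Fin m) (Fin n) ℝ → ℝ) : Prop :=
  (∀ X, N X = 0 ↔ X = 0) ∧ (∀ (c : ℝ) (X), N (c • X) = |c| * N X) ∧
    (∀ X Y, N (X + Y) ≤ N X + N Y)

/-- Dual norm of `N`. -/
def dualNorm (N : Matrix (Fin m) (Fin n) ℝ → ℝ) (A : Matrix (Fin m) (Fin n) ℝ) : ℝ :=
  sSup {r | ∃ Y, N Y ≤ 1 ∧ r = mInner A Y}

/-- `X` is optimal for: minimize `N X` subject to `⟨A,X⟩ ≥ 1`. -/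
def IsOptMin (N : Matrix (Fin m) (Fin n) ℝ → ℝ) (A X : Matrix (Fin m) (Fin n) ℝ) : Prop :=
  1 ≤ mInner A X ∧ ∀ X', 1 ≤ mInner A X' → N X ≤ N X'

/-- `Y` is optimal for: maximize `⟨A,Y⟩` subject to `N Y ≤ 1`. -/
def IsOptMax (N : Matrix (Fin m) (Fin n) ℝ → ℝ) (A Y : Matrix (Fin m) (Fin n) ℝ) : Prop :=
  N Y ≤ 1 ∧ ∀ Y', N Y' ≤ 1 → mInner A Y' ≤ mInner A Y

/-- Subdifferential of `f : ℝ^{m×n} → ℝ` at `A`, with respect to the trace inner product. -/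
def subdiff (f : Matrix (Fin m) (Fin n) ℝ → ℝ) (A : Matrix (Fin m) (Fin n) ℝ) :
    Set (Matrix (Fin m) (Fin n) ℝ) :=
  {Y | ∀ B, f A + mInner (B - A) Y ≤ f B}

/-- A linear functional on a finite-dimensional real space is bounded with respect to any norm. -/
lemma exists_bound_of_norm {E : Type*} [AddCommGroup E] [Module ℝ E] [FiniteDimensional ℝ E]
    (N : E → ℝ) (nonneg : ∀ x, 0 ≤ N x) (eq_zero : ∀ x, N x = 0 ↔ x = 0)
    (smul : ∀ (c : ℝ) (x), N (c • x) = |c| * N x) (add_le : ∀ x y, N (x + y) ≤ N x + N y)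
    (f : E →ₗ[ℝ] ℝ) : ∃ C, 0 ≤ C ∧ ∀ x, f x ≤ C * N x := by
  let _ : Norm E := ⟨N⟩
  have core : NormedSpace.Core ℝ E :=
    { norm_nonneg := nonneg
      norm_smul := smul
      norm_triangle := add_le
      norm_eq_zero_iff := eq_zero }
  let _ : NormedAddCommGroup E := NormedAddCommGroup.ofCore core
  let _ : NormedSpace ℝ E := NormedSpace.ofCore core
  exact ⟨‖LinearMap.toContinuousLinearMap f‖, norm_nonneg _, fun x =>
    (le_abs_self _).trans ((LinearMap.toContinuousLinearMap f).le_opNorm x)⟩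

/-- The trace inner product as a linear functional of its second argument. -/
def mInnerLin (A : Matrix (Fin m) (Fin n) ℝ) : Matrix (Fin m) (Fin n) ℝ →ₗ[ℝ] ℝ where
  toFun := mInner A
  map_add' X Y := by simp [mInner, mul_add, Finset.sum_add_distrib]
  map_smul' c X := by simp [mInner, Finset.mul_sum, mul_left_comm]

lemma mInner_comm (A X : Matrix (Fin m) (Fin n) ℝ) : mInner A X = mInner X A := by
  simp [mInner, mul_comm]

lemma mInner_smul_right (A : Matrix (Fin m) (Fin n) ℝ) (c : ℝ) (X : Matrix (Fin m) (Fin n) ℝ) :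
    mInner A (c • X) = c * mInner A X :=
  (mInnerLin A).map_smul c X

lemma mInner_zero_right (A : Matrix (Fin m) (Fin n) ℝ) : mInner A 0 = 0 :=
  (mInnerLin A).map_zero

lemma mInner_sub_left (A B X : Matrix (Fin m) (Fin n) ℝ) :
    mInner (A - B) X = mInner A X - mInner B X := by
  simp [mInner, sub_mul, Finset.sum_sub_distrib]

lemma mInner_self_pos {A : Matrix (Fin m) (Fin n) ℝ} (hA : A ≠ 0) : 0 < mInner A A := by
  have hnn : ∀ i, 0 ≤ ∑ j, A i j * A i j :=
    fun i => Finset.sum_nonneg fun j _ => mul_self_nonneg _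
  refine (Finset.sum_nonneg fun i _ => hnn i).lt_of_ne fun h => hA ?_
  ext i j
  have hi := (Finset.sum_eq_zero_iff_of_nonneg fun i _ => hnn i).1 h.symm i (Finset.mem_univ i)
  exact mul_self_eq_zero.1 ((Finset.sum_eq_zero_iff_of_nonneg
    fun j _ => mul_self_nonneg (A i j)).1 hi j (Finset.mem_univ j))

/-- Every linear functional on matrices is a trace inner product. -/
lemma exists_eq_mInner (g : Matrix (Fin m) (Fin n) ℝ →ₗ[ℝ] ℝ) : ∃ B, ∀ X, g X = mInner B X := by
  refine ⟨Matrix.of fun i j => g (Matrix.single i j 1), fun X => ?_⟩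
  conv_lhs => rw [Matrix.matrix_eq_sum_single X]
  simp only [map_sum, mInner, Matrix.of_apply]
  refine Finset.sum_congr rfl fun i _ => Finset.sum_congr rfl fun j _ => ?_
  rw [show Matrix.single i j (X i j) = X i j • Matrix.single i j (1 : ℝ) by simp, map_smul,
    smul_eq_mul, mul_comm]

namespace IsMatrixNorm

variable {N : Matrix (Fin m) (Fin n) ℝ → ℝ}

lemma nonneg (hN : IsMatrixNorm N) (X : Matrix (Fin m) (Fin n) ℝ) : 0 ≤ N X := by
  have h := hN.2.2 X ((-1 : ℝ) • X)
  rw [hN.2.1, neg_one_smul, add_neg_cancel, (hN.1 0).2 rfl, abs_neg, abs_one] at h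
  linarith

lemma pos (hN : IsMatrixNorm N) {X : Matrix (Fin m) (Fin n) ℝ} (hX : X ≠ 0) : 0 < N X :=
  (hN.nonneg X).lt_of_ne fun h => hX ((hN.1 X).1 h.symm)

lemma bddAbove (hN : IsMatrixNorm N) (A : Matrix (Fin m) (Fin n) ℝ) :
    BddAbove {r | ∃ Y, N Y ≤ 1 ∧ r = mInner A Y} := by
  obtain ⟨C, hC, h⟩ := exists_bound_of_norm N hN.nonneg hN.1 hN.2.1 hN.2.2 (mInnerLin A)
  refine ⟨C, ?_⟩
  rintro r ⟨Y, hY, rfl⟩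
  exact (h Y).trans (mul_le_of_le_one_right hC hY)

lemma mInner_le_dualNorm (hN : IsMatrixNorm N) (A : Matrix (Fin m) (Fin n) ℝ)
    {Y : Matrix (Fin m) (Fin n) ℝ} (hY : N Y ≤ 1) : mInner A Y ≤ dualNorm N A :=
  le_csSup (hN.bddAbove A) ⟨Y, hY, rfl⟩

lemma dualNorm_le (hN : IsMatrixNorm N) {A : Matrix (Fin m) (Fin n) ℝ} {c : ℝ}
    (h : ∀ Y, N Y ≤ 1 → mInner A Y ≤ c) : dualNorm N A ≤ c := by
  refine csSup_le ⟨mInner A 0, 0, by simp [(hN.1 0).2 rfl], rfl⟩ ?_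
  rintro r ⟨Y, hY, rfl⟩
  exact h Y hY

/-- The generalized Cauchy–Schwarz inequality for a norm and its dual. -/
lemma mInner_le_mul (hN : IsMatrixNorm N) (A X : Matrix (Fin m) (Fin n) ℝ) :
    mInner A X ≤ dualNorm N A * N X := by
  rcases eq_or_ne X 0 with rfl | hX
  · rw [mInner_zero_right, (hN.1 0).2 rfl, mul_zero]
  · have hpos := hN.pos hX
    have h := hN.mInner_le_dualNorm A (Y := (N X)⁻¹ • X) (by
      rw [hN.2.1, abs_of_pos (inv_pos.2 hpos), inv_mul_cancel₀ hpos.ne'])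
    rwa [mInner_smul_right, inv_mul_le_iff₀ hpos, mul_comm] at h

lemma dualNorm_pos (hN : IsMatrixNorm N) {A : Matrix (Fin m) (Fin n) ℝ} (hA : A ≠ 0) :
    0 < dualNorm N A :=
  pos_of_mul_pos_left ((mInner_self_pos hA).trans_le (hN.mInner_le_mul A A)) (hN.nonneg A)

/-- A matrix dominated by the dual norm as a functional lies in the unit ball. -/
lemma le_one_of_mInner_le (hN : IsMatrixNorm N) {Y : Matrix (Fin m) (Fin n) ℝ}
    (h : ∀ B, mInner B Y ≤ dualNorm N B) : N Y ≤ 1 := by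
  rcases eq_or_ne Y 0 with rfl | hY
  · simp [(hN.1 0).2 rfl]
  obtain ⟨g, hg, hgN⟩ := exists_extension_of_le_sublinear
    (LinearPMap.mkSpanSingleton (σ := RingHom.id ℝ) Y (N Y) hY) N
    (fun c hc x => by rw [hN.2.1, abs_of_pos hc]) hN.2.2 (by
      rintro ⟨x, hx⟩
      obtain ⟨c, rfl⟩ := Submodule.mem_span_singleton.1 hx
      rw [LinearPMap.mkSpanSingleton'_apply, hN.2.1]
      exact mul_le_mul_of_nonneg_right (le_abs_self c) (hN.nonneg Y))
  have hgY : g Y = N Y :=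
    (hg ⟨Y, Submodule.mem_span_singleton_self Y⟩).trans
      (LinearPMap.mkSpanSingleton_apply ℝ ℝ hY (N Y))
  obtain ⟨B, hB⟩ := exists_eq_mInner g
  rw [← hgY, hB]
  exact (h B).trans (hN.dualNorm_le fun X hX => (hB X) ▸ (hgN X).trans hX)

/-- The subgradients of the dual norm at `A` are the points of the unit ball attaining it. -/
lemma mem_subdiff_dualNorm_iff (hN : IsMatrixNorm N) {A Y : Matrix (Fin m) (Fin n) ℝ} :
    Y ∈ subdiff (dualNorm N) A ↔ N Y ≤ 1 ∧ mInner A Y = dualNorm N A := by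
  constructor
  · intro h
    have hzero := h 0
    have htwo := h ((2 : ℝ) • A)
    have dual_zero : dualNorm N (0 : Matrix (Fin m) (Fin n) ℝ) ≤ 0 :=
      hN.dualNorm_le fun X _ => by rw [mInner_comm, mInner_zero_right]
    have dual_two : dualNorm N ((2 : ℝ) • A) ≤ 2 * dualNorm N A :=
      hN.dualNorm_le fun X hX => by
        rw [mInner_comm, mInner_smul_right, mInner_comm]
        linarith [hN.mInner_le_dualNorm A hX]
    rw [mInner_sub_left, mInner_comm 0, mInner_zero_right] at hzero
    rw [mInner_sub_left, mInner_comm (_ • _), mInner_smul_right, mInner_comm Y] at htwo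
    have heq : mInner A Y = dualNorm N A := by linarith
    refine ⟨hN.le_one_of_mInner_le fun B => ?_, heq⟩
    have hB := h B
    rw [mInner_sub_left] at hB
    linarith
  · rintro ⟨hY, heq⟩ B
    rw [mInner_sub_left, heq]
    linarith [hN.mInner_le_dualNorm B hY]

/-- The minimal value of `N` on the half-space `⟨A,X⟩ ≥ 1` is the reciprocal of the dual norm. -/
lemma isOptMin_iff (hN : IsMatrixNorm N) {A X : Matrix (Fin m) (Fin n) ℝ} (hA : A ≠ 0) :
    IsOptMin N A X ↔ dualNorm N A * N X ≤ 1 ∧ mInner A X = 1 := by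
  have hd := hN.dualNorm_pos hA
  constructor
  · rintro ⟨hfeas, hmin⟩
    have hX : 0 < N X := pos_of_mul_pos_right
      (zero_lt_one.trans_le (hfeas.trans (hN.mInner_le_mul A X))) hd.le
    have hle : dualNorm N A ≤ (N X)⁻¹ := hN.dualNorm_le fun Y hY => by
      rcases le_or_gt (mInner A Y) 0 with hneg | hpos
      · exact hneg.trans (inv_pos.2 hX).le
      · have h := hmin ((mInner A Y)⁻¹ • Y) (by
          rw [mInner_smul_right, inv_mul_cancel₀ hpos.ne'])
        rw [hN.2.1, abs_of_pos (inv_pos.2 hpos)] at h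
        exact (le_inv_comm₀ hX hpos).1
          (h.trans (mul_le_of_le_one_right (inv_pos.2 hpos).le hY))
    have hprod : dualNorm N A * N X ≤ 1 := (le_inv_mul_iff₀' hX).1 (by simpa using hle)
    exact ⟨hprod, le_antisymm ((hN.mInner_le_mul A X).trans hprod) hfeas⟩
  · rintro ⟨hle, heq⟩
    exact ⟨heq.ge, fun X' hX' => le_of_mul_le_mul_left
      (hle.trans (hX'.trans (hN.mInner_le_mul A X'))) hd⟩

end IsMatrixNorm

theorem stmt2 (N : Matrix (Fin m) (Fin n) ℝ → ℝ) (hN : IsMatrixNorm N)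
    (A : Matrix (Fin m) (Fin n) ℝ) (hA : A ≠ 0) :
    {X | IsOptMin N A X} = (dualNorm N A)⁻¹ • subdiff (dualNorm N) A := by
  have hd := hN.dualNorm_pos hA
  ext X
  rw [Set.mem_inv_smul_set_iff₀ hd.ne', hN.mem_subdiff_dualNorm_iff, Set.mem_ofPred_eq,
    hN.isOptMin_iff hA, hN.2.1, abs_of_pos hd, mInner_smul_right, mul_eq_left₀ hd.ne']

end LAROS
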